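/- Let R be a unital ℂ-algebra and let τ : R → ℂ be a trace, i.e. a ℂ-linear map with τ(xy) = τ(yx) for all x, y ∈ R. Let m ≥ 1 be an odd integer, let F, G, γ ∈ R satisfy F² = 1, G² = 1, γ² = 1, γF = −Fγ and γG = −Gγ, and let x₀, x₁, …, x_{m−1} ∈ R. Writing [G,x] = Gx − xG, one has τ( γ·x₀·[G,x₁]⋯[G,x_{m−1}] − γ·F·x₀·[G,x₁]⋯[G,x_{m−1}]·F ) = τ( γ·G·[G,x₀]·[G,x₁]⋯[G,x_{m−1}] ). -/

import Mathlib

theorem comm_prod_aux {R : Type*} [Ring R] (G : R) (hG : G * G = 1) (x : ℕ → R) (n : ℕ) :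
    G * ((List.range n).map (fun i => G * x (i + 1) - x (i + 1) * G)).prod
      = (-1) ^ n * (((List.range n).map (fun i => G * x (i + 1) - x (i + 1) * G)).prod * G) := by
  induction n with
  | zero => simp
  | succ n ih =>
    rw [List.range_succ, List.map_append, List.prod_append]
    simp only [List.map_cons, List.map_nil, List.prod_cons, List.prod_nil, mul_one]
    have h : G * (G * x (n + 1) - x (n + 1) * G) = -((G * x (n + 1) - x (n + 1) * G) * G) := by
      rw [mul_sub, sub_mul, ← mul_assoc, hG, mul_assoc (x (n+1)), hG, mul_assoc]
      simp
    rw [← mul_assoc, ih, mul_assoc, mul_assoc _ G, h, pow_succ]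
    simp [mul_assoc]

/-- Trace identity for the index cocycle of a perturbed symmetry in the
even-dimensional (graded, `m` odd) case, with grading symmetry `γ`:
`τ(γ x₀ [G,x₁]⋯[G,x_{m-1}] − γ F x₀ [G,x₁]⋯[G,x_{m-1}] F) = τ(γ G [G,x₀][G,x₁]⋯[G,x_{m-1}])`. -/
theorem trace_identity_graded {R : Type*} [Ring R] [Algebra ℂ R]
    (τ : R →ₗ[ℂ] ℂ) (htr : ∀ x y : R, τ (x * y) = τ (y * x))
    (m : ℕ) (hm : 1 ≤ m) (hmo : Odd m)
    (F G γ : R) (hF : F ^ 2 = 1) (hG : G ^ 2 = 1) (hγ : γ ^ 2 = 1)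
    (hγF : γ * F = -(F * γ)) (hγG : γ * G = -(G * γ)) (x : ℕ → R) :
    τ (γ * x 0 * ((List.range (m - 1)).map (fun i => G * x (i + 1) - x (i + 1) * G)).prod
        - γ * F * x 0
          * ((List.range (m - 1)).map (fun i => G * x (i + 1) - x (i + 1) * G)).prod * F)
      = τ (γ * G * (G * x 0 - x 0 * G)
          * ((List.range (m - 1)).map (fun i => G * x (i + 1) - x (i + 1) * G)).prod) := by
  have hG' : G * G = 1 := by rw [← sq, hG]
  have hF' : F * F = 1 := by rw [← sq, hF]
  have hP := comm_prod_aux G hG' x (m - 1)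
  have he : Even (m - 1) := by
    obtain ⟨k, rfl⟩ := hmo
    simp
  rw [he.neg_one_pow, one_mul] at hP
  generalize ((List.range (m - 1)).map (fun i => G * x (i + 1) - x (i + 1) * G)).prod = P at hP ⊢
  have key : ∀ A : R, A * A = 1 → γ * A = -(A * γ) →
      τ (γ * A * x 0 * P * A) = -τ (γ * x 0 * P) := by
    intro A hA hγA
    have h1 : A * (γ * A * x 0 * P) = -(γ * x 0 * P) := by
      rw [hγA]
      simp only [neg_mul, mul_neg, ← mul_assoc, hA, one_mul]
    rw [htr, h1, map_neg]
  have h2 : γ * G * (G * x 0 - x 0 * G) * P = γ * x 0 * P - γ * G * x 0 * P * G := by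
    rw [mul_sub, sub_mul, mul_assoc γ G (G * x 0), ← mul_assoc G G, hG', one_mul,
      mul_assoc _ P G, ← hP]
    simp only [mul_assoc]
  rw [h2, map_sub, map_sub, key F hF' hγF, key G hG' hγG]
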